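/- Let α > 0, a ∈ ℝ, b > 0, and let the family (μ^(k)) be in the mean Nevai class M^(C,α)(Σ_{la,lb}) for the Cesàro weights σ_{n,k}^(C,α), with limits Σ_{la,lb} = a^{la} b^{lb} Γ(α/2+1) Γ(lb/2+1) / Γ((α+lb)/2 + 1). Then the equilibrium measure is the image under the affine map y ↦ 2by + a of the normalized ultraspherical measure with parameter α/2: for every bounded continuous function f : ℝ → ℝ, lim_{n→∞} Σ_{k=0}^n σ_{n,k}^(C,α) ∫_ℝ f(x) (p_k^(n−k)(x))² dμ^(n−k)(x) = (1/((2b)^α m^(α/2))) ∫_{a−2b}^{a+2b} f(x) (4b² − (x−a)²)^{(α−1)/2} dx, where m^(α/2) = ∫_{−1}^1 (1−x²)^{(α−1)/2} dx. -/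

import Mathlib

open Filter MeasureTheory

/-- The weighted means of `|g (n - k) k|` with weights `σ n k` tend to zero. -/
def MeanNull (σ : ℕ → ℕ → ℝ) (g : ℕ → ℕ → ℝ) : Prop :=
  Tendsto (fun n => ∑ k ∈ Finset.range (n + 1), σ n k * |g (n - k) k|) atTop (nhds 0)

namespace MeanNull

variable {σ : ℕ → ℕ → ℝ} {g h c : ℕ → ℕ → ℝ}

theorem mono (hσ0 : ∀ n k, k ≤ n → 0 ≤ σ n k) (hh : MeanNull σ h)
    (hgh : ∀ r k, |g r k| ≤ |h r k|) : MeanNull σ g := by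
  refine squeeze_zero (fun n => ?_) (fun n => ?_) hh
  · exact Finset.sum_nonneg fun k hk =>
      mul_nonneg (hσ0 n k (Finset.mem_range_succ_iff.mp hk)) (abs_nonneg _)
  · exact Finset.sum_le_sum fun k hk =>
      mul_le_mul_of_nonneg_left (hgh _ _) (hσ0 n k (Finset.mem_range_succ_iff.mp hk))

theorem add (hσ0 : ∀ n k, k ≤ n → 0 ≤ σ n k) (hg : MeanNull σ g) (hh : MeanNull σ h) :
    MeanNull σ (fun r k => g r k + h r k) := by
  have hs := Tendsto.add hg hh
  rw [add_zero] at hs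
  refine squeeze_zero (fun n => ?_) (fun n => ?_) hs
  · exact Finset.sum_nonneg fun k hk =>
      mul_nonneg (hσ0 n k (Finset.mem_range_succ_iff.mp hk)) (abs_nonneg _)
  · rw [← Finset.sum_add_distrib]
    refine Finset.sum_le_sum fun k hk => ?_
    rw [← mul_add]
    exact mul_le_mul_of_nonneg_left (abs_add_le _ _) (hσ0 n k (Finset.mem_range_succ_iff.mp hk))

theorem const_mul (C : ℝ) (hg : MeanNull σ g) : MeanNull σ (fun r k => C * g r k) := by
  have hs := Tendsto.const_mul |C| hg
  rw [mul_zero] at hs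
  refine hs.congr fun n => ?_
  rw [Finset.mul_sum]
  refine Finset.sum_congr rfl fun k _ => ?_
  rw [abs_mul]; ring

theorem bdd_mul (hσ0 : ∀ n k, k ≤ n → 0 ≤ σ n k) {C : ℝ} (hc : ∀ r k, |c r k| ≤ C)
    (hg : MeanNull σ g) : MeanNull σ (fun r k => c r k * g r k) := by
  refine (hg.const_mul C).mono hσ0 fun r k => ?_
  rw [abs_mul, abs_mul]
  exact mul_le_mul_of_nonneg_right ((hc r k).trans (le_abs_self C)) (abs_nonneg _)

theorem of_support_lt (hσ0 : ∀ n k, k ≤ n → 0 ≤ σ n k)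
    (hσ2 : ∀ k, Tendsto (fun n => σ n k) atTop (nhds 0)) {C : ℝ} (K : ℕ)
    (hC : ∀ r k, |g r k| ≤ C) (hK : ∀ r k, K ≤ k → g r k = 0) : MeanNull σ g := by
  have hs : Tendsto (fun n => ∑ k ∈ Finset.range K, σ n k * C) atTop (nhds 0) := by
    have := tendsto_finsetSum (Finset.range K) fun k _ => (hσ2 k).mul_const C
    simpa using this
  refine squeeze_zero' (Eventually.of_forall fun n => ?_) ?_ hs
  · exact Finset.sum_nonneg fun k hk =>
      mul_nonneg (hσ0 n k (Finset.mem_range_succ_iff.mp hk)) (abs_nonneg _)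
  · filter_upwards [eventually_ge_atTop K] with n hn
    rw [← Finset.sum_subset (Finset.range_subset_range.mpr (by omega : K ≤ n + 1))]
    · refine Finset.sum_le_sum fun k hk => ?_
      rw [Finset.mem_range] at hk
      exact mul_le_mul_of_nonneg_left (hC _ _) (hσ0 n k (by omega))
    · intro k _ hk
      rw [hK _ _ (by simpa using hk), abs_zero, mul_zero]

theorem congr_of_ge (hσ0 : ∀ n k, k ≤ n → 0 ≤ σ n k)
    (hσ2 : ∀ k, Tendsto (fun n => σ n k) atTop (nhds 0)) {C : ℝ} (K : ℕ)
    (hC : ∀ r k, |g r k| ≤ C) (hh : MeanNull σ h) (hK : ∀ r k, K ≤ k → g r k = h r k) :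
    MeanNull σ g := by
  have h1 : MeanNull σ (fun r k => if K ≤ k then 0 else g r k) := by
    refine of_support_lt hσ0 hσ2 (C := C) K (fun r k => ?_) (fun r k hk => if_pos hk)
    split_ifs
    · simpa using (abs_nonneg _).trans (hC 0 0)
    · exact hC r k
  have h2 : MeanNull σ (fun r k => if K ≤ k then h r k else 0) := by
    refine hh.mono hσ0 fun r k => ?_
    split_ifs <;> simp
  refine (h1.add hσ0 h2).mono hσ0 fun r k => ?_
  split_ifs with hk
  · rw [hK r k hk, zero_add]
  · rw [add_zero]

theorem shift_one (hσ0 : ∀ n k, k ≤ n → 0 ≤ σ n k)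
    (hσ2 : ∀ k, Tendsto (fun n => σ n k) atTop (nhds 0))
    (hσs : ∀ n k, k ≤ n → σ (n + 1) (k + 1) ≤ σ n k) {C : ℝ} (hC : ∀ r k, |g r k| ≤ C)
    (hg : MeanNull σ g) : MeanNull σ (fun r k => g r (k - 1)) := by
  have hs := Tendsto.add hg (((tendsto_add_atTop_iff_nat 1).mpr (hσ2 0)).mul_const C)
  rw [zero_mul, add_zero] at hs
  refine (tendsto_add_atTop_iff_nat 1).mp ?_
  refine squeeze_zero (fun n => ?_) (fun n => ?_) hs
  · exact Finset.sum_nonneg fun k hk =>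
      mul_nonneg (hσ0 _ k (Finset.mem_range_succ_iff.mp hk)) (abs_nonneg _)
  · rw [Finset.sum_range_succ']
    refine add_le_add (Finset.sum_le_sum fun k hk => ?_) ?_
    · simp only [Nat.add_sub_add_right, Nat.add_sub_cancel]
      exact mul_le_mul_of_nonneg_right (hσs n k (Finset.mem_range_succ_iff.mp hk)) (abs_nonneg _)
    · exact mul_le_mul_of_nonneg_left (hC _ _) (hσ0 _ _ (Nat.zero_le _))

theorem shift (hσ0 : ∀ n k, k ≤ n → 0 ≤ σ n k)
    (hσ2 : ∀ k, Tendsto (fun n => σ n k) atTop (nhds 0))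
    (hσs : ∀ n k, k ≤ n → σ (n + 1) (k + 1) ≤ σ n k) {C : ℝ} (hC : ∀ r k, |g r k| ≤ C)
    (hg : MeanNull σ g) (l : ℕ) : MeanNull σ (fun r k => g r (k - l)) := by
  induction l with
  | zero => simpa using hg
  | succ l ih =>
    have := ih.shift_one hσ0 hσ2 hσs (fun r k => hC r _)
    refine this.mono hσ0 fun r k => le_of_eq ?_
    rw [Nat.sub_sub, Nat.add_comm 1 l]

/-- A bounded array varying slowly in the mean under shifts by natural numbers does so under shifts
by integers. -/
theorem int_shift_sub (hσ0 : ∀ n k, k ≤ n → 0 ≤ σ n k)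
    (hσ2 : ∀ k, Tendsto (fun n => σ n k) atTop (nhds 0))
    (hσs : ∀ n k, k ≤ n → σ (n + 1) (k + 1) ≤ σ n k) {C : ℝ} (hC : ∀ r k, |c r k| ≤ C)
    (hc : ∀ l : ℕ, 1 ≤ l → MeanNull σ (fun r k => c r (k + l) - c r k)) (j : ℤ) :
    MeanNull σ (fun r k => c r ((k : ℤ) + j).toNat - c r k) := by
  have hC2 : ∀ r k i, |c r i - c r k| ≤ C + C := fun r k i =>
    (abs_sub _ _).trans (add_le_add (hC _ _) (hC _ _))
  obtain ⟨l, rfl | rfl⟩ := j.eq_nat_or_neg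
  · have he : ∀ k : ℕ, ((k : ℤ) + l).toNat = k + l := fun k => by omega
    simp only [he]
    rcases Nat.eq_zero_or_pos l with rfl | hl
    · simp [MeanNull]
    · exact hc l hl
  · rcases Nat.eq_zero_or_pos l with rfl | hl
    · simp [MeanNull]
    · have h1 := (((hc l hl).shift hσ0 hσ2 hσs (fun r k => hC2 r k _)) l).const_mul (-1)
      refine h1.congr_of_ge hσ0 hσ2 l (fun r k => hC2 _ _ _) fun r k hk => ?_
      have he : ((k : ℤ) + -(l : ℤ)).toNat = k - l := by omega
      rw [he, Nat.sub_add_cancel hk]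
      ring

end MeanNull

/-- The entry at offset `j` of the `m`-th power of the doubly infinite Jacobi matrix with constant
coefficients `a` (diagonal) and `b` (off-diagonal). -/
def toeplitzPow (a b : ℝ) : ℕ → ℤ → ℝ
  | 0, j => if j = 0 then 1 else 0
  | m + 1, j => b * toeplitzPow a b m (j + 1) + a * toeplitzPow a b m j +
      b * toeplitzPow a b m (j - 1)

theorem exists_abs_toeplitzPow_le {A B : ℝ} (hA : 0 ≤ A) (hB : 0 ≤ B) (m : ℕ) :
    ∃ C, 0 ≤ C ∧ ∀ a b, |a| ≤ A → |b| ≤ B → ∀ j, |toeplitzPow a b m j| ≤ C := by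
  induction m with
  | zero =>
    refine ⟨1, zero_le_one, fun a b _ _ j => ?_⟩
    rw [toeplitzPow]
    split_ifs <;> simp
  | succ m ih =>
    obtain ⟨C, hC0, hC⟩ := ih
    refine ⟨B * C + A * C + B * C, by positivity, fun a b ha hb j => ?_⟩
    rw [toeplitzPow]
    refine (abs_add_three _ _ _).trans ?_
    simp only [abs_mul]
    gcongr <;> exact hC a b ha hb _

theorem integral_cos_int_mul (j : ℤ) :
    ∫ θ in (0 : ℝ)..Real.pi, Real.cos (j * θ) = if j = 0 then Real.pi else 0 := by
  split_ifs with h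
  · simp [h]
  · have hj : (j : ℝ) ≠ 0 := by exact_mod_cast h
    rw [intervalIntegral.integral_comp_mul_left (fun x => Real.cos x) hj]
    simp [Real.sin_int_mul_pi]

theorem toeplitzPow_eq_integral (a b : ℝ) (m : ℕ) (j : ℤ) :
    toeplitzPow a b m j = Real.pi⁻¹ *
      ∫ θ in (0 : ℝ)..Real.pi, (a + 2 * b * Real.cos θ) ^ m * Real.cos (j * θ) := by
  induction m generalizing j with
  | zero =>
    simp only [pow_zero, one_mul, integral_cos_int_mul, toeplitzPow]
    split_ifs <;> simp [Real.pi_ne_zero]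
  | succ m ih =>
    have hi : ∀ j : ℤ, IntervalIntegrable
        (fun θ => (a + 2 * b * Real.cos θ) ^ m * Real.cos (j * θ)) volume 0 Real.pi := fun j =>
      Continuous.intervalIntegrable (by fun_prop) _ _
    rw [toeplitzPow, ih, ih, ih]
    have h : ∀ θ : ℝ, (a + 2 * b * Real.cos θ) ^ (m + 1) * Real.cos (j * θ) =
        b * ((a + 2 * b * Real.cos θ) ^ m * Real.cos ((j + 1 : ℤ) * θ)) +
        a * ((a + 2 * b * Real.cos θ) ^ m * Real.cos (j * θ)) +
        b * ((a + 2 * b * Real.cos θ) ^ m * Real.cos ((j - 1 : ℤ) * θ)) := fun θ => by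
      push_cast
      rw [add_mul, sub_mul, one_mul, Real.cos_add, Real.cos_sub]
      ring
    simp only [h]
    rw [intervalIntegral.integral_add (((hi _).const_mul _).add ((hi _).const_mul _))
        ((hi _).const_mul _),
      intervalIntegral.integral_add ((hi _).const_mul _) ((hi _).const_mul _)]
    simp only [intervalIntegral.integral_const_mul]
    ring

theorem toeplitzPow_zero_eq_sum (a b : ℝ) (m : ℕ) :
    toeplitzPow a b m 0 = ∑ i ∈ Finset.range (m + 1), a ^ (m - i) * b ^ i *
      (m.choose i * 2 ^ i * (Real.pi⁻¹ * ∫ θ in (0 : ℝ)..Real.pi, Real.cos θ ^ i)) := by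
  have h : ∀ θ : ℝ, (a + 2 * b * Real.cos θ) ^ m * Real.cos ((0 : ℤ) * θ) =
      ∑ i ∈ Finset.range (m + 1), (a ^ (m - i) * b ^ i * (m.choose i * 2 ^ i)) *
        Real.cos θ ^ i := fun θ => by
    rw [add_comm, add_pow]
    simp only [Int.cast_zero, zero_mul, Real.cos_zero, mul_one]
    refine Finset.sum_congr rfl fun i _ => ?_
    rw [mul_pow, mul_pow]; ring
  rw [toeplitzPow_eq_integral]
  simp only [h]
  rw [intervalIntegral.integral_finsetSum fun i _ =>
    Continuous.intervalIntegrable (by fun_prop) _ _, Finset.mul_sum]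
  refine Finset.sum_congr rfl fun i _ => ?_
  rw [intervalIntegral.integral_const_mul]
  ring

theorem intervalIntegrable_one_sub_sq_rpow {s : ℝ} (hs : -1 < s) :
    IntervalIntegrable (fun y : ℝ => (1 - y ^ 2) ^ s) volume (-1) 1 := by
  have h01 : IntervalIntegrable (fun y : ℝ => (1 - y ^ 2) ^ s) volume 0 1 := by
    have h1 : IntervalIntegrable (fun y : ℝ => (1 - y) ^ s) volume 0 1 := by
      have := ((intervalIntegral.intervalIntegrable_rpow' (a := 0) (b := 1) hs).comp_sub_left 1)
      simpa using this.symm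
    have h2 : ContinuousOn (fun y : ℝ => (1 + y) ^ s) (Set.uIcc 0 1) := by
      refine ContinuousOn.rpow_const (by fun_prop) fun y hy => Or.inl ?_
      rw [Set.uIcc_of_le zero_le_one] at hy
      linarith [hy.1]
    refine (h1.mul_continuousOn h2).congr fun y hy => ?_
    rw [Set.uIoc_of_le zero_le_one] at hy
    change (1 - y) ^ s * (1 + y) ^ s = _
    rw [← Real.mul_rpow (by linarith [hy.2]) (by linarith [hy.1])]
    congr 1; ring
  have h10 : IntervalIntegrable (fun y : ℝ => (1 - y ^ 2) ^ s) volume (-1) 0 := by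
    have := (IntervalIntegrable.iff_comp_neg (f := fun y : ℝ => (1 - y ^ 2) ^ s)).mp h01
    simpa using this.symm
  exact h10.trans h01

theorem integral_one_sub_sq_rpow_pos {s : ℝ} (hs : -1 < s) :
    0 < ∫ y in (-1 : ℝ)..1, (1 - y ^ 2) ^ s := by
  refine intervalIntegral.intervalIntegral_pos_of_pos_on
    (intervalIntegrable_one_sub_sq_rpow hs) (fun y hy => ?_) (by norm_num)
  exact Real.rpow_pos_of_pos (by nlinarith [hy.1, hy.2]) _

theorem integral_pow_add_two_mul_one_sub_sq_rpow {s : ℝ} (hs : -1 < s) (i : ℕ) :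
    (i + 3 + 2 * s) * ∫ y in (-1 : ℝ)..1, y ^ (i + 2) * (1 - y ^ 2) ^ s =
      (i + 1) * ∫ y in (-1 : ℝ)..1, y ^ i * (1 - y ^ 2) ^ s := by
  have hi : ∀ i : ℕ, IntervalIntegrable (fun y : ℝ => y ^ i * (1 - y ^ 2) ^ s) volume (-1) 1 :=
    fun i => (intervalIntegrable_one_sub_sq_rpow hs).continuousOn_mul (by fun_prop)
  have hint := ((hi i).const_mul (i + 1 : ℝ)).sub ((hi (i + 2)).const_mul (i + 3 + 2 * s))
  have key := intervalIntegral.integral_eq_sub_of_hasDerivAt_of_le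
    (f := fun y : ℝ => y ^ (i + 1) * (1 - y ^ 2) ^ (s + 1)) (by norm_num : (-1 : ℝ) ≤ 1)
    (by
      refine ContinuousOn.mul (by fun_prop) (ContinuousOn.rpow_const (by fun_prop) fun y _ =>
        Or.inr (by linarith))) (fun y hy => by
      have hy0 : 0 < 1 - y ^ 2 := by nlinarith [hy.1, hy.2]
      have h1 : HasDerivAt (fun y : ℝ => 1 - y ^ 2) (-(2 * y)) y := by
        simpa using (hasDerivAt_pow 2 y).const_sub 1
      have h2 := (hasDerivAt_pow (i + 1) y).mul (h1.rpow_const (p := s + 1) (Or.inl hy0.ne'))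
      refine h2.congr_deriv (g' := (i + 1 : ℝ) * (y ^ i * (1 - y ^ 2) ^ s) -
        (i + 3 + 2 * s) * (y ^ (i + 2) * (1 - y ^ 2) ^ s)) ?_
      rw [Real.rpow_add_one hy0.ne', add_sub_cancel_right, Nat.add_sub_cancel]
      push_cast
      ring) hint
  rw [intervalIntegral.integral_sub ((hi i).const_mul _) ((hi _).const_mul _),
    intervalIntegral.integral_const_mul, intervalIntegral.integral_const_mul] at key
  have h0 : (0 : ℝ) ^ (s + 1) = 0 := Real.zero_rpow (by linarith)
  norm_num [h0] at key
  linarith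

/-- The moments of the normalized ultraspherical measure in terms of those of the arcsine law. -/
theorem integral_pow_mul_one_sub_sq_rpow_div {α : ℝ} (hα : 0 < α) (i : ℕ) :
    (∫ y in (-1 : ℝ)..1, y ^ i * (1 - y ^ 2) ^ ((α - 1) / 2)) /
        ∫ y in (-1 : ℝ)..1, (1 - y ^ 2) ^ ((α - 1) / 2) =
      (Real.pi⁻¹ * ∫ θ in (0 : ℝ)..Real.pi, Real.cos θ ^ i) *
        (Real.Gamma (α / 2 + 1) * Real.Gamma ((i : ℝ) / 2 + 1) /
          Real.Gamma ((α + (i : ℝ)) / 2 + 1)) := by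
  have hs : -1 < (α - 1) / 2 := by linarith
  have hM := (integral_one_sub_sq_rpow_pos hs).ne'
  have hG : ∀ x : ℝ, 0 ≤ x → Real.Gamma (x + 1) ≠ 0 := fun x hx =>
    (Real.Gamma_pos_of_pos (by linarith)).ne'
  induction i using Nat.twoStepInduction with
  | zero =>
    have := hG (α / 2) (by linarith)
    simp [Real.pi_ne_zero, hM, this]
  | one =>
    have h1 : ∫ y in (-1 : ℝ)..1, y ^ 1 * (1 - y ^ 2) ^ ((α - 1) / 2) = 0 := by
      have := intervalIntegral.integral_comp_neg (a := -1) (b := 1)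
        (fun y : ℝ => y ^ 1 * (1 - y ^ 2) ^ ((α - 1) / 2))
      simp only [neg_neg, even_two, Even.neg_pow, pow_one, neg_mul,
        intervalIntegral.integral_neg] at this ⊢
      linarith
    rw [h1]
    simp
  | more i ih _ =>
    have hrec := integral_pow_add_two_mul_one_sub_sq_rpow hs i
    have hcos : ∫ θ in (0 : ℝ)..Real.pi, Real.cos θ ^ (i + 2) =
        (i + 1) / (i + 2) * ∫ θ in (0 : ℝ)..Real.pi, Real.cos θ ^ i := by
      rw [integral_cos_pow]
      simp
    have e1 : ((i + 2 : ℕ) : ℝ) / 2 + 1 = ((i : ℝ) / 2 + 1) + 1 := by push_cast; ring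
    have e2 : (α + ((i + 2 : ℕ) : ℝ)) / 2 + 1 = ((α + i) / 2 + 1) + 1 := by push_cast; ring
    have p1 : (i : ℝ) / 2 + 1 ≠ 0 := by positivity
    have p2 : (α + (i : ℝ)) / 2 + 1 ≠ 0 := by positivity
    have p3 : α + (i : ℝ) + 2 ≠ 0 := by positivity
    have e3 : ∫ y in (-1 : ℝ)..1, y ^ (i + 2) * (1 - y ^ 2) ^ ((α - 1) / 2) =
        (i + 1) / (α + i + 2) * ∫ y in (-1 : ℝ)..1, y ^ i * (1 - y ^ 2) ^ ((α - 1) / 2) := by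
      rw [div_mul_eq_mul_div, eq_div_iff p3, ← hrec]
      ring
    rw [e1, e2, Real.Gamma_add_one p1, Real.Gamma_add_one p2, hcos, e3, mul_div_assoc, ih]
    have := hG ((α + i) / 2) (by positivity)
    field_simp

theorem integral_affine_one_sub_sq_rpow {α b : ℝ} (a : ℝ) (hb : 0 < b) (f : ℝ → ℝ) :
    (1 / ((2 * b) ^ α * ∫ x in (-1 : ℝ)..1, (1 - x ^ 2) ^ ((α - 1) / 2))) *
        ∫ x in (a - 2 * b)..(a + 2 * b), f x * (4 * b ^ 2 - (x - a) ^ 2) ^ ((α - 1) / 2) =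
      (∫ y in (-1 : ℝ)..1, f (2 * b * y + a) * (1 - y ^ 2) ^ ((α - 1) / 2)) /
        ∫ y in (-1 : ℝ)..1, (1 - y ^ 2) ^ ((α - 1) / 2) := by
  have hb2 : (0 : ℝ) < 2 * b := by linarith
  have h := intervalIntegral.integral_comp_mul_add (a := -1) (b := 1)
    (fun x => f x * (4 * b ^ 2 - (x - a) ^ 2) ^ ((α - 1) / 2)) hb2.ne' a
  rw [show 2 * b * -1 + a = a - 2 * b by ring, show 2 * b * 1 + a = a + 2 * b by ring,
    smul_eq_mul] at h
  have h2 : ∫ y in (-1 : ℝ)..1, f (2 * b * y + a) *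
        (4 * b ^ 2 - (2 * b * y + a - a) ^ 2) ^ ((α - 1) / 2) =
      (2 * b) ^ (α - 1) * ∫ y in (-1 : ℝ)..1, f (2 * b * y + a) *
        (1 - y ^ 2) ^ ((α - 1) / 2) := by
    rw [← intervalIntegral.integral_const_mul]
    refine intervalIntegral.integral_congr fun y hy => ?_
    rw [Set.uIcc_of_le (by norm_num)] at hy
    have hy0 : 0 ≤ 1 - y ^ 2 := by nlinarith [hy.1, hy.2]
    have e : 4 * b ^ 2 - (2 * b * y + a - a) ^ 2 = (2 * b) ^ (2 : ℝ) * (1 - y ^ 2) := by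
      rw [Real.rpow_two]; ring
    change _ * _ = _
    rw [e, Real.mul_rpow (by positivity) hy0, ← Real.rpow_mul hb2.le,
      show 2 * ((α - 1) / 2) = α - 1 by ring]
    ring
  rw [h2, eq_comm, inv_mul_eq_iff_eq_mul₀ hb2.ne'] at h
  rw [h, Real.rpow_sub_one hb2.ne']
  have := Real.rpow_pos_of_pos hb2 α
  field_simp

theorem cesaro_weight_succ_le {α : ℝ} (hα : 0 < α) {σ : ℕ → ℕ → ℝ}
    (hσ0 : ∀ n k, k ≤ n → 0 ≤ σ n k)
    (hσdef : ∀ n k : ℕ, k ≤ n → σ n k =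
      α * Real.Gamma ((n:ℝ)-(k:ℝ)+α) * Real.Gamma ((n:ℝ)+1) /
        (Real.Gamma ((n:ℝ)-(k:ℝ)+1) * Real.Gamma ((n:ℝ)+α+1)))
    (n k : ℕ) (hk : k ≤ n) : σ (n + 1) (k + 1) ≤ σ n k := by
  have h : σ (n + 1) (k + 1) = ((n + 1) / (n + α + 1)) * σ n k := by
    rw [hσdef _ _ (Nat.succ_le_succ hk), hσdef n k hk]
    push_cast
    rw [show (n : ℝ) + 1 - (k + 1) = n - k by ring,
      show (n : ℝ) + 1 + α + 1 = (n + α + 1) + 1 by ring,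
      Real.Gamma_add_one (by positivity : (n : ℝ) + 1 ≠ 0),
      Real.Gamma_add_one (by positivity : (n : ℝ) + α + 1 ≠ 0)]
    rw [div_mul_div_comm]
    congr 1 <;> ring
  rw [h]
  refine mul_le_of_le_one_left (hσ0 n k hk) ?_
  rw [div_le_one (by positivity)]
  linarith

theorem integrable_of_continuous_of_support {ν : Measure ℝ} [IsFiniteMeasure ν] {R : ℝ}
    (hν : ν ((Set.Icc (-R) R)ᶜ) = 0) {g : ℝ → ℝ} (hg : Continuous g) : Integrable g ν := by
  rw [← Measure.restrict_eq_self_of_ae_mem (s := Set.Icc (-R) R) (μ := ν) hν]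
  exact hg.continuousOn.integrableOn_compact isCompact_Icc

/-- In the mean, the entries of powers of the Jacobi matrices are those of Toeplitz matrices. -/
theorem meanNull_integral_pow_sub_toeplitzPow
    (μ : ℕ → Measure ℝ) [∀ k, IsFiniteMeasure (μ k)] {R : ℝ}
    (hsupp : ∀ k, μ k ((Set.Icc (-R) R)ᶜ) = 0)
    (p : ℕ → ℕ → Polynomial ℝ) (ca cb : ℕ → ℕ → ℝ)
    (horth : ∀ k l m, (∫ x, (p k l).eval x * (p k m).eval x ∂ (μ k)) = if l = m then 1 else 0)
    (hrec : ∀ k l, Polynomial.X * p k l =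
      Polynomial.C (cb k (l+1)) * p k (l+1) + Polynomial.C (ca k l) * p k l +
      Polynomial.C (cb k l) * p k (l-1))
    {σ : ℕ → ℕ → ℝ} (hσ0 : ∀ n k, k ≤ n → 0 ≤ σ n k)
    (hσ2 : ∀ k, Tendsto (fun n => σ n k) atTop (nhds 0))
    (hσs : ∀ n k, k ≤ n → σ (n + 1) (k + 1) ≤ σ n k)
    {A B : ℝ} (hA : ∀ k n, |ca k n| ≤ A) (hB : ∀ k n, |cb k n| ≤ B)
    (hNa : ∀ l : ℕ, 1 ≤ l → MeanNull σ (fun r k => ca r (k + l) - ca r k))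
    (hNb : ∀ l : ℕ, 1 ≤ l → MeanNull σ (fun r k => cb r (k + l) - cb r k)) (m : ℕ) (j : ℤ) :
    MeanNull σ (fun r k =>
      (∫ x, x ^ m * ((p r k).eval x * (p r ((k : ℤ) + j).toNat).eval x) ∂ (μ r)) -
        toeplitzPow (ca r k) (cb r k) m j) := by
  have hA0 : 0 ≤ A := (abs_nonneg _).trans (hA 0 0)
  have hB0 : 0 ≤ B := (abs_nonneg _).trans (hB 0 0)
  set v : ℕ → ℕ → ℕ → ℕ → ℝ := fun m r k i =>
    ∫ x, x ^ m * ((p r k).eval x * (p r i).eval x) ∂ (μ r) with hv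
  have hv0 : ∀ r k i, v 0 r k i = if k = i then 1 else 0 := fun r k i => by
    simp only [hv, pow_zero, one_mul, horth]
  have hvs : ∀ m r k i, v (m + 1) r k i =
      cb r (i + 1) * v m r k (i + 1) + ca r i * v m r k i + cb r i * v m r k (i - 1) := by
    intro m r k i
    have hi : ∀ i, Integrable (fun x => x ^ m * ((p r k).eval x * (p r i).eval x)) (μ r) :=
      fun i => integrable_of_continuous_of_support (hsupp r) (by fun_prop)
    have he : ∀ x : ℝ, x ^ (m + 1) * ((p r k).eval x * (p r i).eval x) =
        cb r (i + 1) * (x ^ m * ((p r k).eval x * (p r (i + 1)).eval x)) +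
        ca r i * (x ^ m * ((p r k).eval x * (p r i).eval x)) +
        cb r i * (x ^ m * ((p r k).eval x * (p r (i - 1)).eval x)) := fun x => by
      have := congrArg (Polynomial.eval x) (hrec r i)
      simp only [Polynomial.eval_mul, Polynomial.eval_add, Polynomial.eval_X,
        Polynomial.eval_C] at this
      linear_combination (x ^ m * (p r k).eval x) * this
    simp only [hv, he]
    rw [integral_add (integrable_of_continuous_of_support (hsupp r) (by fun_prop))
        ((hi _).const_mul _), integral_add ((hi _).const_mul _) ((hi _).const_mul _)]
    simp only [integral_const_mul]
  have hvb : ∀ m, ∃ C, 0 ≤ C ∧ ∀ r k i, |v m r k i| ≤ C := by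
    intro m
    induction m with
    | zero =>
      refine ⟨1, zero_le_one, fun r k i => ?_⟩
      rw [hv0]
      split_ifs <;> simp
    | succ m ih =>
      obtain ⟨C, hC0, hC⟩ := ih
      refine ⟨B * C + A * C + B * C, by positivity, fun r k i => ?_⟩
      rw [hvs]
      refine (abs_add_three _ _ _).trans ?_
      simp only [abs_mul]
      gcongr <;> first | exact hC _ _ _ | exact hA _ _ | exact hB _ _
  change MeanNull σ (fun r k => v m r k ((k : ℤ) + j).toNat -
    toeplitzPow (ca r k) (cb r k) m j)
  induction m generalizing j with
  | zero =>
    refine MeanNull.of_support_lt hσ0 hσ2 (C := 1) (-j).toNat (fun r k => ?_) (fun r k hk => ?_)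
    · rw [hv0, toeplitzPow]
      split_ifs <;> simp
    · rw [hv0, toeplitzPow]
      have : k = ((k : ℤ) + j).toNat ↔ j = 0 := by omega
      simp only [this, sub_self]
  | succ m ih =>
    obtain ⟨C, hC0, hC⟩ := hvb m
    obtain ⟨C', _, hC'⟩ := hvb (m + 1)
    obtain ⟨D, _, hD⟩ := exists_abs_toeplitzPow_le hA0 hB0 (m + 1)
    have sa := MeanNull.int_shift_sub hσ0 hσ2 hσs hA hNa
    have sb := MeanNull.int_shift_sub hσ0 hσ2 hσs hB hNb
    have hV : ∀ i : ℤ, ∀ r k : ℕ, |v m r k ((k : ℤ) + i).toNat| ≤ C := fun i r k => hC _ _ _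
    have key := ((((((sb (j + 1)).bdd_mul hσ0 (hV (j + 1))).add hσ0
      ((ih (j + 1)).bdd_mul hσ0 hB)).add hσ0
      ((sa j).bdd_mul hσ0 (hV j))).add hσ0
      ((ih j).bdd_mul hσ0 hA)).add hσ0
      ((sb j).bdd_mul hσ0 (hV (j - 1)))).add hσ0
      ((ih (j - 1)).bdd_mul hσ0 hB)
    refine key.congr_of_ge hσ0 hσ2 (C := C' + D) (-j).toNat (fun r k => ?_) (fun r k hk => ?_)
    · exact (abs_sub _ _).trans (add_le_add (hC' _ _ _) (hD _ _ (hA _ _) (hB _ _) _))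
    · have e1 : ((k : ℤ) + (j + 1)).toNat = ((k : ℤ) + j).toNat + 1 := by omega
      have e2 : ((k : ℤ) + (j - 1)).toNat = ((k : ℤ) + j).toNat - 1 := by omega
      rw [hvs, toeplitzPow, e1, e2]
      ring

/-- Functionals that are contractive for the sup norm on a common compact interval and converge on
polynomials converge on continuous functions. -/
theorem tendsto_of_tendsto_polynomial {S : ℝ} {T : ℕ → (ℝ → ℝ) → ℝ} {Λ : (ℝ → ℝ) → ℝ}
    (hT : ∀ n f q, Continuous f → Continuous q → ∀ ε, (∀ x ∈ Set.Icc (-S) S, |f x - q x| ≤ ε) →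
      |T n f - T n q| ≤ ε)
    (hΛ : ∀ f q, Continuous f → Continuous q → ∀ ε, (∀ x ∈ Set.Icc (-S) S, |f x - q x| ≤ ε) →
      |Λ f - Λ q| ≤ ε)
    (hp : ∀ q : Polynomial ℝ, Tendsto (fun n => T n fun x => q.eval x) atTop
      (nhds (Λ fun x => q.eval x)))
    {f : ℝ → ℝ} (hf : Continuous f) : Tendsto (fun n => T n f) atTop (nhds (Λ f)) := by
  rw [Metric.tendsto_atTop]
  intro ε hε
  obtain ⟨q, hq⟩ := exists_polynomial_near_of_continuousOn (-S) S f hf.continuousOn (ε / 3)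
    (by positivity)
  have hq' : ∀ x ∈ Set.Icc (-S) S, |f x - q.eval x| ≤ ε / 3 := fun x hx => by
    rw [abs_sub_comm]; exact (hq x hx).le
  obtain ⟨N, hN⟩ := Metric.tendsto_atTop.mp (hp q) (ε / 3) (by positivity)
  refine ⟨N, fun n hn => ?_⟩
  have h1 := hT n f _ hf q.continuous _ hq'
  have h2 := hΛ f _ hf q.continuous _ hq'
  have h3 := hN n hn
  rw [Real.dist_eq] at h3 ⊢
  rw [abs_le] at h1 h2
  rw [abs_lt] at h3 ⊢
  constructor <;> linarith

theorem abs_ultraspherical_mean_sub_le {s : ℝ} (hs : -1 < s) {f q : ℝ → ℝ} (hf : Continuous f)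
    (hq : Continuous q) {ε : ℝ} (h : ∀ y ∈ Set.Icc (-1 : ℝ) 1, |f y - q y| ≤ ε) :
    |(∫ y in (-1 : ℝ)..1, f y * (1 - y ^ 2) ^ s) / (∫ y in (-1 : ℝ)..1, (1 - y ^ 2) ^ s) -
      (∫ y in (-1 : ℝ)..1, q y * (1 - y ^ 2) ^ s) / ∫ y in (-1 : ℝ)..1, (1 - y ^ 2) ^ s| ≤ ε := by
  have hM := integral_one_sub_sq_rpow_pos hs
  have hw := intervalIntegrable_one_sub_sq_rpow hs
  have hi : ∀ g : ℝ → ℝ, Continuous g →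
      IntervalIntegrable (fun y : ℝ => g y * (1 - y ^ 2) ^ s) volume (-1) 1 := fun g hg =>
    hw.continuousOn_mul hg.continuousOn
  rw [← sub_div, abs_div, abs_of_pos hM, div_le_iff₀ hM,
    ← intervalIntegral.integral_sub (hi f hf) (hi q hq), ← intervalIntegral.integral_const_mul,
    ← Real.norm_eq_abs]
  refine intervalIntegral.norm_integral_le_of_norm_le (by norm_num)
    (ae_of_all _ fun y hy => ?_) (hw.const_mul ε)
  have hy0 : 0 ≤ (1 - y ^ 2) ^ s := Real.rpow_nonneg (by nlinarith [hy.1, hy.2]) _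
  rw [← sub_mul, norm_mul, Real.norm_eq_abs, Real.norm_of_nonneg hy0]
  exact mul_le_mul_of_nonneg_right (h y ⟨hy.1.le, hy.2⟩) hy0

theorem abs_integral_mul_sq_sub_le {ν : Measure ℝ} [IsFiniteMeasure ν] {R : ℝ}
    (hν : ν ((Set.Icc (-R) R)ᶜ) = 0) {u f q : ℝ → ℝ} (hu : Continuous u)
    (hu1 : ∫ x, u x ^ 2 ∂ν = 1) (hf : Continuous f) (hq : Continuous q) {ε : ℝ}
    (h : ∀ x ∈ Set.Icc (-R) R, |f x - q x| ≤ ε) :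
    |(∫ x, f x * u x ^ 2 ∂ν) - ∫ x, q x * u x ^ 2 ∂ν| ≤ ε := by
  have hi : ∀ g : ℝ → ℝ, Continuous g → Integrable g ν := fun g hg =>
    integrable_of_continuous_of_support hν hg
  rw [← integral_sub (hi _ (by fun_prop)) (hi _ (by fun_prop)), ← Real.norm_eq_abs]
  have hb : ∀ᵐ x ∂ν, ‖f x * u x ^ 2 - q x * u x ^ 2‖ ≤ ε * u x ^ 2 := by
    have hmem : ∀ᵐ x ∂ν, x ∈ Set.Icc (-R) R := hν
    filter_upwards [hmem] with x hx
    rw [← sub_mul, norm_mul, Real.norm_eq_abs, Real.norm_of_nonneg (sq_nonneg (u x))]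
    exact mul_le_mul_of_nonneg_right (h x hx) (sq_nonneg _)
  refine (norm_integral_le_of_norm_le (hi _ (by fun_prop)) hb).trans_eq ?_
  rw [integral_const_mul, hu1, mul_one]

theorem stmt19 (α : ℝ) (hα : 0 < α) (a₀ b₀ : ℝ) (hb₀ : 0 < b₀)
    (μ : ℕ → MeasureTheory.Measure ℝ)
    (hfin : ∀ k, MeasureTheory.IsFiniteMeasure (μ k))
    (hsupp : ∃ R : ℝ, ∀ k, μ k ((Set.Icc (-R) R)ᶜ) = 0)
    (p : ℕ → ℕ → Polynomial ℝ) (ca cb : ℕ → ℕ → ℝ)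
    (hdeg : ∀ k l, (p k l).natDegree = l)
    (hlead : ∀ k l, 0 < (p k l).leadingCoeff)
    (horth : ∀ k l m, (∫ x, (p k l).eval x * (p k m).eval x ∂ (μ k)) = if l = m then 1 else 0)
    (hb0 : ∀ k, cb k 0 = 0)
    (hbpos : ∀ k l, 0 < cb k (l+1))
    (hrec : ∀ k l, Polynomial.X * p k l =
      Polynomial.C (cb k (l+1)) * p k (l+1) + Polynomial.C (ca k l) * p k l +
      Polynomial.C (cb k l) * p k (l-1))
    (σ : ℕ → ℕ → ℝ)
    (hσ0 : ∀ n k, k ≤ n → 0 ≤ σ n k)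
    (hσ1 : ∀ n, ∑ k ∈ Finset.range (n+1), σ n k = 1)
    (hσ2 : ∀ k, Filter.Tendsto (fun n => σ n k) Filter.atTop (nhds 0))
    (hσdef : ∀ n k : ℕ, k ≤ n → σ n k =
      α * Real.Gamma ((n:ℝ)-(k:ℝ)+α) * Real.Gamma ((n:ℝ)+1) /
        (Real.Gamma ((n:ℝ)-(k:ℝ)+1) * Real.Gamma ((n:ℝ)+α+1)))
    (hbdA : ∃ A : ℝ, ∀ k n, |ca k n| ≤ A)
    (hbdB : ∃ B : ℝ, ∀ k n, cb k n ≤ B)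
    (hNa : ∀ l : ℕ, 1 ≤ l → Filter.Tendsto
      (fun n => ∑ k ∈ Finset.range (n+1), σ n k * |ca (n-k) (k+l) - ca (n-k) k|)
      Filter.atTop (nhds 0))
    (hNb : ∀ l : ℕ, 1 ≤ l → Filter.Tendsto
      (fun n => ∑ k ∈ Finset.range (n+1), σ n k * |cb (n-k) (k+l) - cb (n-k) k|)
      Filter.atTop (nhds 0))
    (hNs : ∀ la lb : ℕ, Filter.Tendsto
      (fun n => ∑ k ∈ Finset.range (n+1), σ n k * (ca (n-k) k)^la * (cb (n-k) k)^lb)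
      Filter.atTop (nhds (a₀^la * b₀^lb * Real.Gamma (α/2+1) * Real.Gamma ((lb:ℝ)/2+1) / Real.Gamma ((α+(lb:ℝ))/2+1))))
    :
    ∀ f : ℝ → ℝ, Continuous f → (∃ C : ℝ, ∀ x, |f x| ≤ C) →
      Filter.Tendsto (fun n => ∑ k ∈ Finset.range (n+1),
          σ n k * ∫ x, f x * ((p (n-k) k).eval x)^2 ∂ (μ (n-k)))
          Filter.atTop
        (nhds ((1 / ((2*b₀) ^ α * ∫ x in (-1:ℝ)..1, (1 - x^2) ^ ((α-1)/2))) *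
          ∫ x in (a₀ - 2*b₀)..(a₀ + 2*b₀), f x * (4*b₀^2 - (x - a₀)^2) ^ ((α-1)/2))) := by
  obtain ⟨R, hsupp⟩ := hsupp
  obtain ⟨A, hA⟩ := hbdA
  obtain ⟨B, hB⟩ := hbdB
  have hs : -1 < (α - 1) / 2 := by linarith
  have hB' : ∀ k n, |cb k n| ≤ B := fun k n => by
    rw [abs_of_nonneg]
    · exact hB k n
    · cases n with
      | zero => exact (hb0 k).ge
      | succ n => exact (hbpos k n).le
  have hσs := cesaro_weight_succ_le hα hσ0 hσdef
  have hu1 : ∀ r k, ∫ x, (p r k).eval x ^ 2 ∂ (μ r) = 1 := fun r k => by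
    have := horth r k k
    simpa only [← sq, if_true] using this
  set w : ℝ → ℝ := fun y => (1 - y ^ 2) ^ ((α - 1) / 2)
  set M : ℝ := ∫ y in (-1 : ℝ)..1, (1 - y ^ 2) ^ ((α - 1) / 2)
  have hmono : ∀ m : ℕ, Tendsto (fun n => ∑ k ∈ Finset.range (n + 1),
      σ n k * ∫ x, x ^ m * (p (n - k) k).eval x ^ 2 ∂ (μ (n - k))) atTop
      (nhds ((∫ y in (-1 : ℝ)..1, (2 * b₀ * y + a₀) ^ m * w y) / M)) := by
    intro m
    have h1 := meanNull_integral_pow_sub_toeplitzPow μ hsupp p ca cb horth hrec hσ0 hσ2 hσs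
      hA hB' hNa hNb m 0
    simp only [add_zero, Int.toNat_natCast] at h1
    have h1' : Tendsto (fun n => ∑ k ∈ Finset.range (n + 1), σ n k *
        ((∫ x, x ^ m * ((p (n - k) k).eval x * (p (n - k) k).eval x) ∂ (μ (n - k))) -
          toeplitzPow (ca (n - k) k) (cb (n - k) k) m 0)) atTop (nhds 0) := by
      refine squeeze_zero_norm (fun n => ?_) h1
      refine (norm_sum_le _ _).trans_eq (Finset.sum_congr rfl fun k hk => ?_)
      rw [norm_mul, Real.norm_of_nonneg (hσ0 n k (Finset.mem_range_succ_iff.mp hk)),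
        Real.norm_eq_abs]
    have h2 := tendsto_finsetSum (Finset.range (m + 1)) fun i _ =>
      (hNs (m - i) i).mul_const
        (m.choose i * 2 ^ i * (Real.pi⁻¹ * ∫ θ in (0 : ℝ)..Real.pi, Real.cos θ ^ i))
    have h3 := h1'.add h2
    rw [zero_add] at h3
    have hlim : (∫ y in (-1 : ℝ)..1, (2 * b₀ * y + a₀) ^ m * w y) / M =
        ∑ i ∈ Finset.range (m + 1), (a₀ ^ (m - i) * b₀ ^ i * Real.Gamma (α / 2 + 1) *
          Real.Gamma ((i : ℝ) / 2 + 1) / Real.Gamma ((α + (i : ℝ)) / 2 + 1)) *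
          (m.choose i * 2 ^ i * (Real.pi⁻¹ * ∫ θ in (0 : ℝ)..Real.pi, Real.cos θ ^ i)) := by
      have he : ∀ y : ℝ, (2 * b₀ * y + a₀) ^ m * w y = ∑ i ∈ Finset.range (m + 1),
          (a₀ ^ (m - i) * b₀ ^ i * (m.choose i * 2 ^ i)) * (y ^ i * w y) := fun y => by
        rw [add_pow, Finset.sum_mul]
        refine Finset.sum_congr rfl fun i _ => ?_
        rw [mul_pow, mul_pow]; ring
      simp only [he]
      rw [intervalIntegral.integral_finsetSum fun i _ =>
        (((intervalIntegrable_one_sub_sq_rpow hs).continuousOn_mul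
          (continuous_pow i).continuousOn).const_mul _), Finset.sum_div]
      refine Finset.sum_congr rfl fun i _ => ?_
      rw [intervalIntegral.integral_const_mul, mul_div_assoc,
        integral_pow_mul_one_sub_sq_rpow_div hα i]
      ring
    rw [hlim]
    refine h3.congr fun n => ?_
    simp only [Finset.sum_mul]
    rw [Finset.sum_comm, ← Finset.sum_add_distrib]
    refine Finset.sum_congr rfl fun k _ => ?_
    rw [toeplitzPow_zero_eq_sum, mul_sub, Finset.mul_sum]
    simp only [← sq]
    rw [sub_add_eq_add_sub, sub_eq_iff_eq_add]
    congr 1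
    exact Finset.sum_congr rfl fun i _ => by ring
  have hi : ∀ r k : ℕ, ∀ g : ℝ → ℝ, Continuous g →
      Integrable (fun x => g x * (p r k).eval x ^ 2) (μ r) := fun r k g hg =>
    integrable_of_continuous_of_support (hsupp r) (by fun_prop)
  have hiw : ∀ g : ℝ → ℝ, Continuous g →
      IntervalIntegrable (fun y => g (2 * b₀ * y + a₀) * w y) volume (-1) 1 := fun g hg =>
    (intervalIntegrable_one_sub_sq_rpow hs).continuousOn_mul
      (hg.comp (by fun_prop)).continuousOn
  intro f hf _
  rw [integral_affine_one_sub_sq_rpow a₀ hb₀ f]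
  refine tendsto_of_tendsto_polynomial (S := max R (|a₀| + 2 * b₀))
    (T := fun n g => ∑ k ∈ Finset.range (n + 1),
      σ n k * ∫ x, g x * (p (n - k) k).eval x ^ 2 ∂ (μ (n - k)))
    (Λ := fun g => (∫ y in (-1 : ℝ)..1, g (2 * b₀ * y + a₀) * w y) / M) ?_ ?_ ?_ hf
  · intro n f q hf hq ε h
    have hk : ∀ k, |(∫ x, f x * (p (n - k) k).eval x ^ 2 ∂ (μ (n - k))) -
        ∫ x, q x * (p (n - k) k).eval x ^ 2 ∂ (μ (n - k))| ≤ ε := fun k =>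
      abs_integral_mul_sq_sub_le (hsupp _) (p (n - k) k).continuous (hu1 _ _) hf hq
        fun x hx => h x (Set.Icc_subset_Icc (neg_le_neg (le_max_left _ _)) (le_max_left _ _) hx)
    rw [← Finset.sum_sub_distrib]
    refine (Finset.abs_sum_le_sum_abs _ _).trans ?_
    calc _ ≤ ∑ k ∈ Finset.range (n + 1), σ n k * ε := Finset.sum_le_sum fun k hk' => by
          have h0 := hσ0 n k (Finset.mem_range_succ_iff.mp hk')
          rw [← mul_sub, abs_mul, abs_of_nonneg h0]
          exact mul_le_mul_of_nonneg_left (hk k) h0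
      _ = ε := by rw [← Finset.sum_mul, hσ1, one_mul]
  · intro f q hf hq ε h
    refine abs_ultraspherical_mean_sub_le hs (f := fun y => f (2 * b₀ * y + a₀))
      (q := fun y => q (2 * b₀ * y + a₀)) (by fun_prop) (by fun_prop) fun y hy => h _ ?_
    have h1 := le_max_right R (|a₀| + 2 * b₀)
    have h2 := abs_le.mp (le_refl |a₀|)
    constructor <;> nlinarith [hy.1, hy.2]
  · intro q
    induction q using Polynomial.induction_on' with
    | add q₁ q₂ h₁ h₂ =>
      have hadd := h₁.add h₂
      simp only [Polynomial.eval_add, add_mul]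
      rw [intervalIntegral.integral_add (hiw _ q₁.continuous) (hiw _ q₂.continuous), add_div]
      refine hadd.congr fun n => ?_
      rw [← Finset.sum_add_distrib]
      refine Finset.sum_congr rfl fun k _ => ?_
      rw [integral_add (hi _ _ _ q₁.continuous) (hi _ _ _ q₂.continuous), mul_add]
    | monomial m c =>
      simp only [Polynomial.eval_monomial, mul_assoc c, intervalIntegral.integral_const_mul,
        integral_const_mul, mul_div_assoc]
      refine ((hmono m).const_mul c).congr fun n => ?_
      rw [Finset.mul_sum]
      exact Finset.sum_congr rfl fun k _ => by ring
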